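/- Suppose t ∈ ℝ satisfies F(t) < 1 and the hazard rate x ↦ f(x)/(1−F(x)) is nondecreasing on {x ≥ t : F(x) < 1}. Then for every prize schedule v ∈ 𝒱, g(t; v) ≤ g(t; v^WTA) = B_1(t). (If the noise distribution has an increasing failure rate above the threshold t, the winner-take-all schedule maximizes the marginal benefit of effort at that threshold.) -/

import Mathlib

open MeasureTheory

/-- The CDF associated with a density `f`. -/
noncomputable def Fcdf (f : ℝ → ℝ) (x : ℝ) : ℝ := ∫ u in Set.Iic x, f u

/-- `F_{(j:m)}`, the CDF of the `j`-th smallest of `m` i.i.d. draws (binomial-sum form),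
with the convention `F_{(0:m)} ≡ 1`. -/
noncomputable def Fos (f : ℝ → ℝ) (j m : ℕ) (x : ℝ) : ℝ :=
  if j = 0 then 1
  else ∑ k ∈ Finset.Icc j m, (m.choose k : ℝ) * Fcdf f x ^ k * (1 - Fcdf f x) ^ (m - k)

/-- `f_{(j:m)}`, the density of the `j`-th smallest of `m` i.i.d. draws,
with the convention `f_{(0:m)} ≡ 0`. -/
noncomputable def fos (f : ℝ → ℝ) (j m : ℕ) (x : ℝ) : ℝ :=
  if j = 0 then 0
  else (j : ℝ) * (m.choose j : ℝ) * Fcdf f x ^ (j - 1) * (1 - Fcdf f x) ^ (m - j) * f x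

/-- The marginal-benefit coefficient `B_r(t)`. -/
noncomputable def Bcoef (f : ℝ → ℝ) (n r : ℕ) (t : ℝ) : ℝ :=
  f t * Fos f (n - r) (n - 1) t + ∫ x in Set.Ioi t, f x * fos f (n - r) (n - 1) x

/-- The marginal benefit of effort `g(t; v)` with threshold `t` and prize schedule `v`. -/
noncomputable def gmb (f : ℝ → ℝ) (n : ℕ) (v : ℕ → ℝ) (t : ℝ) : ℝ :=
  ∑ r ∈ Finset.Icc 1 n, Bcoef f n r t * (v r - v (r + 1))

/-- A noise density: nonnegative, bounded, integrating to one, vanishing outside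
`[xl, xu]` and continuous there.  The endpoints may be infinite. -/
def IsNoiseDensity (f : ℝ → ℝ) (xl xu : EReal) : Prop :=
  xl < xu ∧ (∀ x, 0 ≤ f x) ∧ (∃ M, ∀ x, f x ≤ M) ∧ (∫ x, f x = 1) ∧
    (∀ x : ℝ, ((x : EReal) < xl ∨ xu < (x : EReal)) → f x = 0) ∧
    ContinuousOn f {x : ℝ | xl ≤ (x : EReal) ∧ (x : EReal) ≤ xu}

/-- A prize schedule `v = (v 1, …, v n)`: nonincreasing, nonnegative, summing to one,
with the convention `v (n+1) = 0`. -/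
def IsPrizeSchedule (n : ℕ) (v : ℕ → ℝ) : Prop :=
  (∀ r ∈ Finset.Icc 1 n, 0 ≤ v r) ∧ (∀ r, 1 ≤ r → r < n → v (r + 1) ≤ v r) ∧
    (∑ r ∈ Finset.Icc 1 n, v r = 1) ∧ v (n + 1) = 0

/-- `m` is a mode of `f`. -/
def IsMode (f : ℝ → ℝ) (m : ℝ) : Prop :=
  ∃ a b : ℝ, a < m ∧ m < b ∧ MonotoneOn f (Set.Icc a m) ∧ AntitoneOn f (Set.Icc m b) ∧
    f a < f m ∧ f b < f m

/-- `f` is piecewise monotone: away from finitely many points it is monotone. -/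
def PiecewiseMonotone (f : ℝ → ℝ) : Prop :=
  ∃ s : Finset ℝ, ∀ a b : ℝ, a < b → (∀ c ∈ s, c ∉ Set.Ioo a b) →
    MonotoneOn f (Set.Ioo a b) ∨ AntitoneOn f (Set.Ioo a b)

open Set Filter Topology

/-- Binomial tail: the CDF of the `j`-th order statistic of `m` uniform draws. -/
noncomputable def binomTail (j m : ℕ) (u : ℝ) : ℝ :=
  ∑ k ∈ Finset.Icc j m, (m.choose k : ℝ) * u ^ k * (1 - u) ^ (m - k)

/-- The density of the `j`-th order statistic of `m` uniform draws. -/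
noncomputable def betaDensity (j m : ℕ) (u : ℝ) : ℝ :=
  (j : ℝ) * (m.choose j : ℝ) * u ^ (j - 1) * (1 - u) ^ (m - j)

lemma binomTail_zero (m : ℕ) (u : ℝ) : binomTail 0 m u = 1 := by
  have h := add_pow u (1 - u) m
  rw [add_sub_cancel, one_pow, Finset.range_eq_Ico] at h
  refine Eq.trans (Finset.sum_congr ?_ fun k _ => by ring) h.symm
  ext k
  simp

lemma binomTail_eq_add {j m : ℕ} (h : j ≤ m) (u : ℝ) :
    binomTail j m u = (m.choose j : ℝ) * u ^ j * (1 - u) ^ (m - j) + binomTail (j + 1) m u := by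
  rw [binomTail, ← Finset.add_sum_Ioc_eq_sum_Icc h, binomTail]
  congr 2
  ext k
  simp

lemma binomTail_self (m : ℕ) (u : ℝ) : binomTail m m u = u ^ m := by
  simp [binomTail]

lemma binomTail_one {j m : ℕ} (h : j ≤ m) : binomTail j m 1 = 1 := by
  rw [binomTail, Finset.sum_eq_single_of_mem m (by simp [h])]
  · simp
  · intro k hk hkm
    have : m - k ≠ 0 := by have := Finset.mem_Icc.1 hk; omega
    simp [this]

lemma binomTail_antitone {i j m : ℕ} (h : i ≤ j) {u : ℝ} (h0 : 0 ≤ u) (h1 : u ≤ 1) :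
    binomTail j m u ≤ binomTail i m u := by
  refine Finset.sum_le_sum_of_subset_of_nonneg (Finset.Icc_subset_Icc_left h) fun k _ _ => ?_
  have := sub_nonneg.2 h1
  positivity

lemma hasDerivAt_binomTail {j m : ℕ} (h : j ≤ m) (u : ℝ) :
    HasDerivAt (binomTail j m) (betaDensity j m u) u := by
  induction h using Nat.decreasingInduction with
  | self =>
    have : binomTail m m = fun u => u ^ m := funext (binomTail_self m)
    rw [this]
    simpa [betaDensity] using hasDerivAt_pow m u
  | of_succ j hj ih =>
    have : binomTail j m = fun u =>
        (m.choose j : ℝ) * u ^ j * (1 - u) ^ (m - j) + binomTail (j + 1) m u :=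
      funext (binomTail_eq_add hj.le)
    rw [this]
    have h1 := ((hasDerivAt_pow j u).const_mul (m.choose j : ℝ)).mul
      (((hasDerivAt_id u).const_sub 1).pow (m - j))
    refine (h1.add ih).congr_deriv ?_
    have hc : (m.choose (j + 1) : ℝ) * (j + 1) = m.choose j * ((m - j : ℕ) : ℝ) := by
      exact_mod_cast Nat.choose_succ_right_eq m j
    have e : m - (j + 1) = m - j - 1 := by omega
    simp only [betaDensity, Nat.cast_add, Nat.cast_one, add_tsub_cancel_right, e, id, Pi.pow_apply]
    linear_combination u ^ j * (1 - u) ^ (m - j - 1) * hc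

lemma continuous_betaDensity (j m : ℕ) : Continuous (betaDensity j m) := by
  unfold betaDensity; fun_prop

lemma cast_choose_succ_mul_sub {m k : ℕ} (h : k ≤ m) :
    ((m + 1).choose k : ℝ) * (m + 1 - k) = (m + 1) * m.choose k := by
  have hk : ((m + 1 - k : ℕ) : ℝ) = m + 1 - k := by
    rw [Nat.cast_sub (by omega)]; push_cast; ring
  rw [← hk, mul_comm (m + 1 : ℝ)]
  exact_mod_cast (Nat.choose_mul_succ_eq m k).symm

/-- Drawing one more sample turns `1 - u` times a beta density into another beta density. -/
lemma betaDensity_succ {j m : ℕ} (h : j ≤ m) (u : ℝ) :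
    (m + 1 : ℝ) * ((1 - u) * betaDensity j m u) = (m + 1 - j) * betaDensity j (m + 1) u := by
  have hc := cast_choose_succ_mul_sub h
  simp only [betaDensity, Nat.succ_sub h, pow_succ]
  linear_combination (-(j : ℝ) * u ^ (j - 1) * (1 - u) ^ (m - j) * (1 - u)) * hc

lemma mul_binomTail_le {j m : ℕ} (h : j ≤ m) {u : ℝ} (h0 : 0 ≤ u) (h1 : u ≤ 1) :
    (m + 1 : ℝ) * ((1 - u) * binomTail j m u) ≤
      (m + 1 - j) * (binomTail j (m + 1) u - u ^ (m + 1)) := by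
  have e : binomTail j (m + 1) u - u ^ (m + 1) =
      ∑ k ∈ Finset.Icc j m, ((m + 1).choose k : ℝ) * u ^ k * (1 - u) ^ (m + 1 - k) := by
    rw [binomTail, Finset.sum_Icc_succ_top (by omega)]
    simp
  rw [e, binomTail, Finset.mul_sum, Finset.mul_sum, Finset.mul_sum]
  refine Finset.sum_le_sum fun k hk => ?_
  obtain ⟨hjk, hkm⟩ := Finset.mem_Icc.1 hk
  have hc := cast_choose_succ_mul_sub hkm
  have hu := sub_nonneg.2 h1
  calc (m + 1 : ℝ) * ((1 - u) * (m.choose k * u ^ k * (1 - u) ^ (m - k)))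
      = (m + 1 - k) * ((m + 1).choose k * u ^ k * (1 - u) ^ (m + 1 - k)) := by
        rw [Nat.succ_sub hkm, pow_succ]
        linear_combination (-u ^ k * (1 - u) ^ (m - k) * (1 - u)) * hc
    _ ≤ _ := by
        have : (j : ℝ) ≤ k := by exact_mod_cast hjk
        gcongr

/-- The difference of a top order statistic density and a multiple of a lower one changes sign at
most once, from negative to positive. -/
lemma exists_betaDensity_crossing {j m : ℕ} (h : j < m) {a : ℝ} (ha : 0 ≤ a) :
    ∃ u₀ < 1, ∀ u, 0 ≤ u → u ≤ 1 →
      (u ≤ u₀ → betaDensity m m u - a * betaDensity j m u ≤ 0) ∧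
      (u₀ ≤ u → 0 ≤ betaDensity m m u - a * betaDensity j m u) := by
  rcases Nat.eq_zero_or_pos j with rfl | hj
  · refine ⟨-1, by norm_num, fun u h0 h1 => ⟨fun h => by linarith, fun _ => ?_⟩⟩
    simp only [betaDensity, Nat.cast_zero, zero_mul, mul_zero, sub_zero, Nat.sub_self, pow_zero]
    positivity
  set c : ℝ := a * (j * m.choose j)
  have hc : 0 ≤ c := by positivity
  set b : ℝ → ℝ := fun u => m * u ^ (m - j) - c * (1 - u) ^ (m - j) with hb
  have hmj : m - j ≠ 0 := by omega
  have hm : (0 : ℝ) < m := by exact_mod_cast (by omega : 0 < m)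
  have hq : ∀ u, betaDensity m m u - a * betaDensity j m u = u ^ (j - 1) * b u := by
    intro u
    have : u ^ (m - 1) = u ^ (j - 1) * u ^ (m - j) := by rw [← pow_add]; congr 1; omega
    simp only [betaDensity, hb, c, this, Nat.choose_self, Nat.sub_self]
    push_cast
    ring
  have hmono : ∀ u v, 0 ≤ u → u ≤ v → v ≤ 1 → b u ≤ b v := by
    intro u v h0 huv h1
    have : 0 ≤ 1 - v := sub_nonneg.2 h1
    simp only [hb]
    gcongr
  have hcont : ContinuousOn b (Icc 0 1) := by simp only [hb]; fun_prop
  obtain ⟨u₀, hu₀, hbu⟩ := intermediate_value_Icc zero_le_one hcont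
    (show (0 : ℝ) ∈ Icc (b 0) (b 1) by simp [hb, hmj, hc])
  have hu1 : u₀ < 1 := by
    refine hu₀.2.lt_of_ne fun h => ?_
    rw [h] at hbu
    simp [hb, hmj] at hbu
    omega
  refine ⟨u₀, hu1, fun u h0 h1 => ?_⟩
  rw [hq]
  refine ⟨fun h => mul_nonpos_of_nonneg_of_nonpos (by positivity) ?_,
    fun h => mul_nonneg (by positivity) ?_⟩
  · exact hbu ▸ hmono u u₀ h0 h hu₀.2
  · exact hbu ▸ hmono u₀ u hu₀.1 h h1

section CDF

variable {f : ℝ → ℝ} {xl xu : EReal}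

lemma IsNoiseDensity.integrable (hf : IsNoiseDensity f xl xu) : Integrable f :=
  Integrable.of_integral_ne_zero (by rw [hf.2.2.2.1]; exact one_ne_zero)

lemma Fcdf_sub (hf : Integrable f) (a x : ℝ) : Fcdf f x - Fcdf f a = ∫ u in a..x, f u :=
  intervalIntegral.integral_Iic_sub_Iic hf.integrableOn hf.integrableOn

lemma Fcdf_eq (hf : Integrable f) (a : ℝ) :
    Fcdf f = fun x => Fcdf f a + ∫ u in a..x, f u := by
  ext x; rw [← Fcdf_sub hf]; ring

lemma continuous_Fcdf (hf : Integrable f) : Continuous (Fcdf f) := by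
  rw [Fcdf_eq hf 0]
  exact continuous_const.add
    (intervalIntegral.continuous_primitive (fun _ _ => hf.intervalIntegrable) 0)

lemma Fcdf_nonneg (h0 : ∀ x, 0 ≤ f x) (x : ℝ) : 0 ≤ Fcdf f x :=
  integral_nonneg h0

lemma Fcdf_mono (hf : Integrable f) (h0 : ∀ x, 0 ≤ f x) : Monotone (Fcdf f) := by
  intro x y hxy
  exact setIntegral_mono_set hf.integrableOn (ae_of_all _ h0)
    (Iic_subset_Iic.2 hxy).eventuallyLE

lemma Fcdf_le_integral (hf : Integrable f) (h0 : ∀ x, 0 ≤ f x) (x : ℝ) :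
    Fcdf f x ≤ ∫ u, f u :=
  setIntegral_le_integral hf (ae_of_all _ h0)

lemma tendsto_Fcdf_atTop (hf : Integrable f) : Tendsto (Fcdf f) atTop (𝓝 (∫ u, f u)) := by
  rw [Fcdf_eq hf 0, ← intervalIntegral.integral_Iic_add_Ioi (b := 0) hf.integrableOn
    hf.integrableOn]
  exact tendsto_const_nhds.add
    (intervalIntegral_tendsto_integral_Ioi 0 hf.integrableOn tendsto_id)

lemma hasDerivAt_Fcdf (hf : Integrable f) {x : ℝ} (hx : ContinuousAt f x) :
    HasDerivAt (Fcdf f) (f x) x := by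
  rw [Fcdf_eq hf 0]
  exact (intervalIntegral.integral_hasDerivAt_right hf.intervalIntegrable
    (hf.aestronglyMeasurable.stronglyMeasurableAtFilter) hx).const_add _

lemma IsNoiseDensity.continuousAt (hf : IsNoiseDensity f xl xu) {x : ℝ}
    (hl : (x : EReal) ≠ xl) (hu : (x : EReal) ≠ xu) : ContinuousAt f x := by
  obtain ⟨-, -, -, -, hz, hc⟩ := hf
  have hcoe : Continuous ((↑) : ℝ → EReal) := continuous_coe_real_ereal
  have hzero : ∀ s : Set ℝ, IsOpen s → x ∈ s → (∀ y ∈ s, f y = 0) → ContinuousAt f x :=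
    fun s hs hxs h => (continuousAt_const (y := (0 : ℝ))).congr <|
      (eventually_of_mem (hs.mem_nhds hxs) h).mono fun y hy => hy.symm
  rcases lt_or_gt_of_ne hl with h | h
  · exact hzero {y : ℝ | (y : EReal) < xl} (isOpen_lt hcoe continuous_const) h
      fun y hy => hz y (Or.inl hy)
  rcases lt_or_gt_of_ne hu with h' | h'
  · refine hc.continuousAt ?_
    filter_upwards [(isOpen_lt continuous_const hcoe).mem_nhds h,
      (isOpen_lt hcoe continuous_const).mem_nhds h'] with y hy hy'
    exact ⟨le_of_lt hy, le_of_lt hy'⟩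
  · exact hzero {y : ℝ | xu < (y : EReal)} (isOpen_lt continuous_const hcoe) h'
      fun y hy => hz y (Or.inr hy)

lemma IsNoiseDensity.Fcdf_le_one (hf : IsNoiseDensity f xl xu) (x : ℝ) : Fcdf f x ≤ 1 :=
  hf.2.2.2.1 ▸ Fcdf_le_integral hf.integrable hf.2.1 x

lemma IsNoiseDensity.integrable_comp_mul (hf : IsNoiseDensity f xl xu) {q : ℝ → ℝ}
    (hq : Continuous q) : Integrable fun x => q (Fcdf f x) * f x := by
  obtain ⟨C, hC⟩ := isCompact_Icc.exists_bound_of_continuousOn (hq.continuousOn (s := Icc 0 1))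
  exact hf.integrable.bdd_mul (c := C)
    (hq.comp (continuous_Fcdf hf.integrable)).aestronglyMeasurable
    (ae_of_all _ fun x => hC _ ⟨Fcdf_nonneg hf.2.1 x, hf.Fcdf_le_one x⟩)

lemma IsNoiseDensity.integrable_mul_comp_mul (hf : IsNoiseDensity f xl xu) {q : ℝ → ℝ}
    (hq : Continuous q) : Integrable fun x => f x * (q (Fcdf f x) * f x) := by
  obtain ⟨M, hM⟩ := hf.2.2.1
  refine (hf.integrable_comp_mul hq).bdd_mul (c := M) hf.integrable.aestronglyMeasurable
    (ae_of_all _ fun x => ?_)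
  rw [Real.norm_of_nonneg (hf.2.1 x)]
  exact hM x

/-- Change of variables `u = F x` on a half-line. -/
lemma IsNoiseDensity.integral_Ioi_comp_mul (hf : IsNoiseDensity f xl xu) {P p : ℝ → ℝ}
    (hP : ∀ u, HasDerivAt P (p u) u) (hp : Continuous p) (t : ℝ) :
    ∫ x in Ioi t, p (Fcdf f x) * f x = P 1 - P (Fcdf f t) := by
  have hPc : Continuous P := continuous_iff_continuousAt.2 fun u => (hP u).continuousAt
  have hF := continuous_Fcdf hf.integrable
  have hint := hf.integrable_comp_mul hp
  have h1 := intervalIntegral_tendsto_integral_Ioi t hint.integrableOn tendsto_id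
  have h2 : Tendsto (fun b => P (Fcdf f b) - P (Fcdf f t)) atTop (𝓝 (P 1 - P (Fcdf f t))) :=
    ((hPc.tendsto 1).comp (hf.2.2.2.1 ▸ tendsto_Fcdf_atTop hf.integrable)).sub_const _
  refine tendsto_nhds_unique h1 (h2.congr fun b => ?_)
  have hs : {x : ℝ | (x : EReal) = xl ∨ (x : EReal) = xu}.Countable := by
    have : ∀ y : EReal, {x : ℝ | (x : EReal) = y}.Countable := fun y =>
      Set.Subsingleton.countable fun a ha b hb => EReal.coe_injective (ha.trans hb.symm)
    exact (this xl).union (this xu)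
  refine (integral_eq_of_hasDerivAt_off_countable (fun x => P (Fcdf f x)) _ hs
    (hPc.comp hF).continuousOn (fun x hx => ?_) hint.intervalIntegrable).symm
  have hx2 := not_or.1 hx.2
  exact (hP _).comp x (hasDerivAt_Fcdf hf.integrable (hf.continuousAt hx2.1 hx2.2))

/-- With an increasing hazard rate above `t`, replacing the hazard rate by its value at `t` lowers
the integral against a weight which crosses zero once, from below, and has nonnegative mass. -/
lemma IsNoiseDensity.hazard_mul_integral_le (hf : IsNoiseDensity f xl xu) {t : ℝ}
    (ht : Fcdf f t < 1)
    (hifr : ∀ x y : ℝ, t ≤ x → x ≤ y → Fcdf f x < 1 → Fcdf f y < 1 →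
      f x / (1 - Fcdf f x) ≤ f y / (1 - Fcdf f y))
    {q : ℝ → ℝ} (hq : Continuous q) {u₀ : ℝ} (hu₀ : u₀ < 1)
    (hsign : ∀ u, 0 ≤ u → u ≤ 1 → (u ≤ u₀ → q u ≤ 0) ∧ (u₀ ≤ u → 0 ≤ q u))
    (hmass : 0 ≤ ∫ x in Ioi t, (1 - Fcdf f x) * q (Fcdf f x) * f x) :
    f t / (1 - Fcdf f t) * ∫ x in Ioi t, (1 - Fcdf f x) * q (Fcdf f x) * f x ≤
      ∫ x in Ioi t, f x * (q (Fcdf f x) * f x) := by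
  have hF := continuous_Fcdf hf.integrable
  have hmono := Fcdf_mono hf.integrable hf.2.1
  obtain ⟨z, htz, hz1, hzlo, hzhi⟩ : ∃ z, t ≤ z ∧ Fcdf f z < 1 ∧
      (∀ x, t < x → x < z → q (Fcdf f x) ≤ 0) ∧ ∀ x, z ≤ x → 0 ≤ q (Fcdf f x) := by
    have hs := fun x => hsign (Fcdf f x) (Fcdf_nonneg hf.2.1 x) (hf.Fcdf_le_one x)
    rcases le_or_gt u₀ (Fcdf f t) with h | h
    · exact ⟨t, le_rfl, ht, fun x h1 h2 => absurd h1 h2.not_gt,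
        fun x hx => (hs x).2 (h.trans (hmono hx))⟩
    · have hlim : Tendsto (Fcdf f) atTop (𝓝 1) :=
        hf.2.2.2.1 ▸ tendsto_Fcdf_atTop hf.integrable
      obtain ⟨b, hb, htb⟩ :=
        ((hlim.eventually_const_lt hu₀).and (eventually_ge_atTop t)).exists
      obtain ⟨z, hz, hzu⟩ := intermediate_value_Icc htb hF.continuousOn ⟨h.le, hb.le⟩
      exact ⟨z, hz.1, hzu ▸ hu₀, fun x _ h2 => (hs x).1 (hzu ▸ hmono h2.le),
        fun x h2 => (hs x).2 (hzu ▸ hmono h2)⟩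
  set c := f z / (1 - Fcdf f z)
  calc _ ≤ c * ∫ x in Ioi t, (1 - Fcdf f x) * q (Fcdf f x) * f x :=
        mul_le_mul_of_nonneg_right (hifr t z le_rfl htz ht hz1) hmass
    _ = ∫ x in Ioi t, c * ((1 - Fcdf f x) * q (Fcdf f x) * f x) :=
        (integral_const_mul _ _).symm
    _ ≤ _ := by
        refine setIntegral_mono_on ?_ (hf.integrable_mul_comp_mul hq).integrableOn
          measurableSet_Ioi fun x hx => ?_
        · exact ((hf.integrable_comp_mul (q := fun u => (1 - u) * q u)
            (by fun_prop)).const_mul c).integrableOn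
        have hfx := hf.2.1 x
        suffices h : 0 ≤ q (Fcdf f x) * (f x - c * (1 - Fcdf f x)) by
          linear_combination f x * h
        rcases lt_or_ge x z with hxz | hzx
        · have hx1 : Fcdf f x < 1 := (hmono hxz.le).trans_lt hz1
          have := hifr x z (le_of_lt hx) hxz.le hx1 hz1
          rw [div_le_iff₀ (sub_pos.2 hx1)] at this
          exact mul_nonneg_of_nonpos_of_nonpos (hzlo x hx hxz) (sub_nonpos.2 this)
        · refine mul_nonneg (hzhi x hzx) ?_
          rcases (hf.Fcdf_le_one x).lt_or_eq with hx1 | hx1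
          · have := hifr z x htz hzx hz1 hx1
            rw [le_div_iff₀ (sub_pos.2 hx1)] at this
            exact sub_nonneg.2 this
          · simpa [hx1] using hfx

lemma Bcoef_eq (f : ℝ → ℝ) (n r : ℕ) (t : ℝ) :
    Bcoef f n r t = f t * binomTail (n - r) (n - 1) (Fcdf f t) +
      ∫ x in Ioi t, f x * (betaDensity (n - r) (n - 1) (Fcdf f x) * f x) := by
  have h1 : ∀ j m x, Fos f j m x = binomTail j m (Fcdf f x) := by
    intro j m x
    unfold Fos
    split_ifs with h
    · rw [h, binomTail_zero]
    · rfl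
  have h2 : ∀ j m x, fos f j m x = betaDensity j m (Fcdf f x) * f x := by
    intro j m x
    unfold fos
    split_ifs with h
    · simp [h, betaDensity]
    · rfl
  simp only [Bcoef, h1, h2]

/-- With an increasing hazard rate above `t`, the `r`-th coefficient is at most `r` times the
first one. -/
lemma IsNoiseDensity.Bcoef_le (hf : IsNoiseDensity f xl xu) {t : ℝ} (ht : Fcdf f t < 1)
    (hifr : ∀ x y : ℝ, t ≤ x → x ≤ y → Fcdf f x < 1 → Fcdf f y < 1 →
      f x / (1 - Fcdf f x) ≤ f y / (1 - Fcdf f y))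
    {n r : ℕ} (hr : 1 ≤ r) (hrn : r ≤ n) : Bcoef f n r t ≤ r * Bcoef f n 1 t := by
  rcases hr.eq_or_lt with rfl | hr2
  · simp
  obtain ⟨m, rfl⟩ : ∃ m, n = m + 1 := ⟨n - 1, by omega⟩
  obtain ⟨j, hj⟩ : ∃ j, j = m + 1 - r := ⟨_, rfl⟩
  have hjm : j < m := by omega
  have hrj : (r : ℝ) = m + 1 - j := by
    rw [hj, Nat.cast_sub hrn]; push_cast; ring
  have hr0 : (0 : ℝ) < r := by exact_mod_cast hr
  have hm0 : (0 : ℝ) < m + 1 := by positivity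
  rw [Bcoef_eq, Bcoef_eq, ← hj, Nat.add_sub_cancel]
  set u := Fcdf f t with hu
  have hu0 : 0 ≤ u := Fcdf_nonneg hf.2.1 t
  set q : ℝ → ℝ := fun u => betaDensity m m u - (r : ℝ)⁻¹ * betaDensity j m u with hqdef
  have hbm := continuous_betaDensity m m
  have hbj := continuous_betaDensity j m
  have hqc : Continuous q := by fun_prop
  obtain ⟨u₀, hu₀, hsign⟩ := exists_betaDensity_crossing hjm (inv_nonneg.2 hr0.le)
  have hqint : ∫ x in Ioi t, (1 - Fcdf f x) * q (Fcdf f x) * f x =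
      (m + 1 : ℝ)⁻¹ * (binomTail j (m + 1) u - binomTail m (m + 1) u) := by
    have hd : ∀ w, HasDerivAt
        (fun w => (m + 1 : ℝ)⁻¹ * (binomTail m (m + 1) w - binomTail j (m + 1) w))
        ((1 - w) * q w) w := by
      intro w
      refine (((hasDerivAt_binomTail (by omega) w).sub
        (hasDerivAt_binomTail (by omega) w)).const_mul _).congr_deriv ?_
      have e1 := betaDensity_succ (le_refl m) w
      have e2 := betaDensity_succ hjm.le w
      rw [← hrj] at e2
      simp only [hqdef]
      field_simp
      linear_combination -r * e1 + e2
    rw [hf.integral_Ioi_comp_mul hd (by fun_prop) t, binomTail_one (by omega),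
      binomTail_one (by omega)]
    ring
  have hmass : 0 ≤ binomTail j (m + 1) u - binomTail m (m + 1) u :=
    sub_nonneg.2 (binomTail_antitone hjm.le hu0 ht.le)
  have key := hf.hazard_mul_integral_le ht hifr hqc hu₀ hsign
    (by rw [hqint]; positivity)
  have hsplit : ∫ x in Ioi t, f x * (q (Fcdf f x) * f x) =
      (∫ x in Ioi t, f x * (betaDensity m m (Fcdf f x) * f x)) -
        (r : ℝ)⁻¹ * ∫ x in Ioi t, f x * (betaDensity j m (Fcdf f x) * f x) := by
    rw [← integral_const_mul, ← integral_sub (hf.integrable_mul_comp_mul hbm).integrableOn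
      ((hf.integrable_mul_comp_mul hbj).const_mul _).integrableOn]
    refine integral_congr_ae (ae_of_all _ fun x => ?_)
    simp only [hqdef]
    ring
  rw [hqint, hsplit, ← hu] at key
  have hu1 : 0 < 1 - u := sub_pos.2 ht
  have hft : f t = f t / (1 - u) * (1 - u) := (div_mul_cancel₀ _ hu1.ne').symm
  set h := f t / (1 - u)
  have hh : 0 ≤ h := div_nonneg (hf.2.1 t) hu1.le
  rw [hft]
  set I := ∫ x in Ioi t, f x * (betaDensity m m (Fcdf f x) * f x)
  set J := ∫ x in Ioi t, f x * (betaDensity j m (Fcdf f x) * f x)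
  have e1 : binomTail m (m + 1) u = (m + 1) * u ^ m * (1 - u) + u ^ (m + 1) := by
    rw [binomTail_eq_add (by omega), binomTail_self]
    simp
  have hle := mul_binomTail_le hjm.le hu0 ht.le
  rw [← hrj] at hle
  have hle' : (1 - u) * binomTail j m u ≤
      r * ((1 - u) * u ^ m + (m + 1 : ℝ)⁻¹ * (binomTail j (m + 1) u - binomTail m (m + 1) u)) := by
    rw [e1]
    field_simp
    linear_combination hle
  have hkey := mul_le_mul_of_nonneg_left key hr0.le
  have : (r : ℝ) * (I - (r : ℝ)⁻¹ * J) = r * I - J := by field_simp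
  rw [this] at hkey
  rw [binomTail_self]
  linear_combination h * hle' + hkey

end CDF

lemma sum_Icc_mul_sub_succ (v : ℕ → ℝ) (n : ℕ) :
    ∑ r ∈ Finset.Icc 1 n, (r : ℝ) * (v r - v (r + 1)) =
      ∑ r ∈ Finset.Icc 1 n, v r - n * v (n + 1) := by
  induction n with
  | zero => simp
  | succ n ih =>
    rw [Finset.sum_Icc_succ_top (by omega), Finset.sum_Icc_succ_top (by omega), ih]
    push_cast
    ring

/-- If the hazard rate of the noise is nondecreasing on `{x ≥ t : F x < 1}`
(IFR above the threshold `t`, where `F t < 1`), then the winner-take-all schedule maximizes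
the marginal benefit of effort at that threshold: `g(t; v) ≤ g(t; v^WTA) = B_1(t)`. -/
theorem stmt6 (n : ℕ) (hn : 2 ≤ n) (f : ℝ → ℝ) (xl xu : EReal)
    (hf : IsNoiseDensity f xl xu) (t : ℝ) (ht : Fcdf f t < 1)
    (hifr : ∀ x y : ℝ, t ≤ x → x ≤ y → Fcdf f x < 1 → Fcdf f y < 1 →
      f x / (1 - Fcdf f x) ≤ f y / (1 - Fcdf f y)) :
    gmb f n (fun r => if r = 1 then (1 : ℝ) else 0) t = Bcoef f n 1 t ∧
      ∀ v : ℕ → ℝ, IsPrizeSchedule n v → gmb f n v t ≤ Bcoef f n 1 t := by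
  constructor
  · rw [gmb, Finset.sum_eq_single_of_mem 1 (by simp; omega)]
    · simp
    · intro r hr hr1
      have := Finset.mem_Icc.1 hr
      simp [hr1, show r ≠ 0 by omega]
  · rintro v ⟨hv0, hvmono, hvsum, hvn⟩
    have hsum := sum_Icc_mul_sub_succ v n
    rw [hvsum, hvn, mul_zero, sub_zero] at hsum
    calc gmb f n v t
        ≤ ∑ r ∈ Finset.Icc 1 n, r * Bcoef f n 1 t * (v r - v (r + 1)) := by
          refine Finset.sum_le_sum fun r hr => ?_
          obtain ⟨h1, h2⟩ := Finset.mem_Icc.1 hr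
          refine mul_le_mul_of_nonneg_right (hf.Bcoef_le ht hifr h1 h2) (sub_nonneg.2 ?_)
          rcases h2.lt_or_eq with h | rfl
          · exact hvmono r h1 h
          · exact hvn ▸ hv0 r hr
      _ = Bcoef f n 1 t * ∑ r ∈ Finset.Icc 1 n, (r : ℝ) * (v r - v (r + 1)) := by
          rw [Finset.mul_sum]
          exact Finset.sum_congr rfl fun r _ => by ring
      _ = Bcoef f n 1 t := by rw [hsum, mul_one]
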